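/- For every integer n ≥ 3, every real c > 0 and every x ≥ x₀, one has (γ(x) + n·c)·x·ω'(x) = (2·γ(x) − x·γ'(x) − 3n·c)·ω(x); equivalently, ω'(x)/ω(x) = (2α(x) − x·α'(x) − 3n·c)/(x·(α(x) + n·c)). -/

import Mathlib

open Real Filter

noncomputable def alphaF (n : ℕ) (c : ℝ) (x : ℝ) : ℝ :=
  (n : ℝ) * c + ((n : ℝ) / (2 * ((n : ℝ) - 1))) * x
    - (((n : ℝ) - 2) / (2 * ((n : ℝ) - 1))) * Real.sqrt (x ^ 2 + 4 * ((n : ℝ) - 1) * c * x)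

noncomputable def yn (n : ℕ) : ℝ :=
  4 * (1 - (n : ℝ)) + (2 * ((n : ℝ) ^ 2 - 4) / Real.sqrt (2 * (n : ℝ) - 5)) *
    Real.cos ((1 / 3) * Real.arctan (((n : ℝ) ^ 2 - 4 * (n : ℝ) + 6) /
      (2 * ((n : ℝ) - 1) * Real.sqrt (2 * (n : ℝ) - 5))))

noncomputable def x0 (n : ℕ) (c : ℝ) : ℝ := yn n * c

noncomputable def betaF (n : ℕ) (c : ℝ) (x : ℝ) : ℝ :=
  alphaF n c (x0 n c) + deriv (alphaF n c) (x0 n c) * (x - x0 n c)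
    + (1 / 2) * deriv (deriv (alphaF n c)) (x0 n c) * (x - x0 n c) ^ 2

noncomputable def gammaF (n : ℕ) (c : ℝ) (x : ℝ) : ℝ :=
  if x0 n c ≤ x then alphaF n c x else betaF n c x

noncomputable def gammaF' (n : ℕ) (c : ℝ) (x : ℝ) : ℝ :=
  derivWithin (gammaF n c) (Set.Ici 0) x

noncomputable def gammaF'' (n : ℕ) (c : ℝ) (x : ℝ) : ℝ :=
  derivWithin (gammaF' n c) (Set.Ici 0) x

noncomputable def omegaF (n : ℕ) (c : ℝ) (x : ℝ) : ℝ :=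
  (x ^ 2 / Real.sqrt (x ^ 2 + 4 * ((n : ℝ) - 1) * c * x)) *
    ((1 + (n : ℝ) ^ 2 * c / x) *
      (((n : ℝ) / ((n : ℝ) - 2) - (1 + 4 * ((n : ℝ) - 1) * c / x) ^ (-(1 / 2) : ℝ)) /
       ((n : ℝ) / ((n : ℝ) - 2) + (1 + 4 * ((n : ℝ) - 1) * c / x) ^ (-(1 / 2) : ℝ)))) ^ 2

theorem yn_pos {n : ℕ} (hn : 3 ≤ n) : 0 < yn n := by
  have hn' : (3 : ℝ) ≤ n := by exact_mod_cast hn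
  unfold yn
  set m : ℝ := (n : ℝ)
  set s := Real.sqrt (2 * m - 5) with hs
  have hs0 : 0 < s := Real.sqrt_pos.2 (by linarith)
  have hs2 : s ^ 2 = 2 * m - 5 := Real.sq_sqrt (by linarith)
  set A := (m ^ 2 - 4 * m + 6) / (2 * (m - 1) * s) with hA
  have hm1 : 0 < m - 1 := by linarith
  have hA0 : 0 < A := div_pos (by nlinarith) (by positivity)
  have hcos : Real.sqrt 3 / 2 < Real.cos (1 / 3 * Real.arctan A) := by
    rw [← Real.cos_pi_div_six]
    have h1 := Real.arctan_lt_pi_div_two A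
    have h2 : 0 < Real.arctan A := Real.arctan_pos.2 hA0
    exact Real.cos_lt_cos_of_nonneg_of_le_pi (by positivity) (by linarith [Real.pi_pos])
      (by linarith)
  have hm4 : 0 < m ^ 2 - 4 := by nlinarith
  have hbound : 4 * (m - 1) * s ≤ Real.sqrt 3 * (m ^ 2 - 4) := by
    refine le_of_sq_le_sq ?_ (by positivity)
    rw [mul_pow, mul_pow, mul_pow, hs2, Real.sq_sqrt (by norm_num)]
    have : 0 ≤ (m - 4) ^ 2 * (3 * m ^ 2 - 8 * m + 8) := mul_nonneg (sq_nonneg _) (by nlinarith)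
    linarith
  have hlt : 4 * (m - 1) < 2 * (m ^ 2 - 4) / s * Real.cos (1 / 3 * Real.arctan A) := by
    rw [div_mul_eq_mul_div, lt_div_iff₀ hs0]
    nlinarith [mul_lt_mul_of_pos_left hcos hm4]
  linarith

theorem x0_pos {n : ℕ} (hn : 3 ≤ n) {c : ℝ} (hc : 0 < c) : 0 < x0 n c :=
  mul_pos (yn_pos hn) hc

theorem hasDerivAt_sqrt_sq_add_linear {k x : ℝ} (hk : 0 < k) (hx : 0 < x) :
    HasDerivAt (fun y => Real.sqrt (y ^ 2 + k * y))
      ((2 * x + k) / (2 * Real.sqrt (x ^ 2 + k * x))) x := by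
  have h : HasDerivAt (fun y : ℝ => y ^ 2 + k * y) (2 * x + k) x := by
    exact ((hasDerivAt_pow 2 x).add ((hasDerivAt_id x).const_mul k)).congr_deriv (by simp)
  exact h.sqrt (by positivity)

theorem hasDerivAt_alphaF {n : ℕ} (hn : 3 ≤ n) {c x : ℝ} (hc : 0 < c) (hx : 0 < x) :
    HasDerivAt (alphaF n c)
      (n / (2 * (n - 1)) - (n - 2) / (2 * (n - 1)) *
        ((2 * x + 4 * (n - 1) * c) / (2 * Real.sqrt (x ^ 2 + 4 * (n - 1) * c * x)))) x := by
  have hn' : (3 : ℝ) ≤ n := by exact_mod_cast hn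
  have hk : 0 < 4 * ((n : ℝ) - 1) * c := mul_pos (by linarith) hc
  have h := (((hasDerivAt_id x).const_mul ((n : ℝ) / (2 * (n - 1)))).const_add (n * c)).sub
    ((hasDerivAt_sqrt_sq_add_linear hk hx).const_mul (((n : ℝ) - 2) / (2 * (n - 1))))
  exact h.congr_deriv (by simp)

theorem hasDerivAt_betaF_x0 (n : ℕ) (c : ℝ) :
    HasDerivAt (betaF n c) (deriv (alphaF n c) (x0 n c)) (x0 n c) := by
  have h := (hasDerivAt_id (x0 n c)).sub_const (x0 n c)
  have h' := ((h.const_mul (deriv (alphaF n c) (x0 n c))).const_add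
    (alphaF n c (x0 n c))).add
    ((h.pow 2).const_mul ((1 / 2) * deriv (deriv (alphaF n c)) (x0 n c)))
  exact h'.congr_deriv (by simp)

theorem hasDerivAt_gammaF {n : ℕ} (hn : 3 ≤ n) {c x : ℝ} (hc : 0 < c) (hx : x0 n c ≤ x) :
    HasDerivAt (gammaF n c) (deriv (alphaF n c) x) x := by
  have hα : HasDerivAt (alphaF n c) (deriv (alphaF n c) x) x :=
    (hasDerivAt_alphaF hn hc ((x0_pos hn hc).trans_le hx)).differentiableAt.hasDerivAt
  rcases hx.eq_or_lt with rfl | hlt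
  · have hr : HasDerivWithinAt (gammaF n c) (deriv (alphaF n c) (x0 n c)) (Set.Ici (x0 n c))
        (x0 n c) :=
      hα.hasDerivWithinAt.congr (fun y hy => if_pos hy) (if_pos le_rfl)
    have hl : HasDerivWithinAt (gammaF n c) (deriv (alphaF n c) (x0 n c)) (Set.Iic (x0 n c))
        (x0 n c) := by
      have hβ : gammaF n c (x0 n c) = betaF n c (x0 n c) := by simp [gammaF, betaF]
      refine (hasDerivAt_betaF_x0 n c).hasDerivWithinAt.congr (fun y hy => ?_) hβ
      rcases (Set.mem_Iic.1 hy).eq_or_lt with rfl | hy'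
      · exact hβ
      · exact if_neg hy'.not_ge
    have := hl.union hr
    rwa [Set.Iic_union_Ici, hasDerivWithinAt_univ] at this
  · refine hα.congr_of_eventuallyEq ?_
    filter_upwards [Ioi_mem_nhds hlt] with y hy
    exact if_pos (le_of_lt hy)

theorem omegaF_eq {n : ℕ} (hn : 3 ≤ n) {c x : ℝ} (hc : 0 < c) (hx : 0 < x) :
    omegaF n c x = (n * Real.sqrt (x ^ 2 + 4 * (n - 1) * c * x) - (n - 2) * x) ^ 4 /
      (16 * ((n : ℝ) - 1) ^ 2 * (x ^ 2 * Real.sqrt (x ^ 2 + 4 * (n - 1) * c * x))) := by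
  have hn' : (3 : ℝ) ≤ n := by exact_mod_cast hn
  have hk : 0 < 4 * ((n : ℝ) - 1) * c := mul_pos (by linarith) hc
  have hpow : (1 + 4 * ((n : ℝ) - 1) * c / x) ^ (-(1 / 2) : ℝ) =
      x / Real.sqrt (x ^ 2 + 4 * (n - 1) * c * x) := by
    have h1 : x ^ 2 + 4 * ((n : ℝ) - 1) * c * x = x ^ 2 * (1 + 4 * (n - 1) * c / x) := by
      field_simp
    rw [h1, Real.sqrt_mul (sq_nonneg x), Real.sqrt_sq hx.le, Real.rpow_neg (by positivity),
      ← Real.sqrt_eq_rpow]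
    have : 0 < Real.sqrt (1 + 4 * ((n : ℝ) - 1) * c / x) := Real.sqrt_pos.2 (by positivity)
    field_simp
  unfold omegaF
  rw [hpow]
  set m : ℝ := (n : ℝ)
  set r := Real.sqrt (x ^ 2 + 4 * (m - 1) * c * x) with hr
  have hr0 : 0 < r := Real.sqrt_pos.2 (by positivity)
  have hr2 : r ^ 2 = x ^ 2 + 4 * (m - 1) * c * x := Real.sq_sqrt (by positivity)
  have hm1 : m - 1 ≠ 0 := by linarith
  have hm2 : 0 < m - 2 := by linarith
  have hm2' := hm2.ne'
  have hE : 0 < m * r + (m - 2) * x := by positivity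
  have hquot : (m / (m - 2) - x / r) / (m / (m - 2) + x / r) =
      (m * r - (m - 2) * x) / (m * r + (m - 2) * x) := by
    rw [div_add_div _ _ hm2' hr0.ne', div_sub_div _ _ hm2' hr0.ne',
      div_div_div_cancel_right₀ (by positivity)]
  have hprod : 1 + m ^ 2 * c / x =
      (m * r - (m - 2) * x) * (m * r + (m - 2) * x) / (4 * (m - 1) * x ^ 2) := by
    rw [eq_div_iff (by positivity)]
    field_simp
    linear_combination (-m ^ 2) * hr2
  rw [hquot, hprod]
  field_simp
  ring

theorem sqrt_sq_add_linear_gt {k x : ℝ} (hk : 0 < k) (hx : 0 < x) :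
    x < Real.sqrt (x ^ 2 + k * x) :=
  Real.lt_sqrt_of_sq_lt (by nlinarith [mul_pos hk hx])

theorem omegaF_pos {n : ℕ} (hn : 3 ≤ n) {c x : ℝ} (hc : 0 < c) (hx : 0 < x) :
    0 < omegaF n c x := by
  have hn' : (3 : ℝ) ≤ n := by exact_mod_cast hn
  have hn1 : 0 < (n : ℝ) - 1 := by linarith
  have hlt := sqrt_sq_add_linear_gt (k := 4 * ((n : ℝ) - 1) * c) (by positivity) hx
  have hr0 := hx.trans hlt
  rw [omegaF_eq hn hc hx]
  have hD : 0 < n * Real.sqrt (x ^ 2 + 4 * ((n : ℝ) - 1) * c * x) - (n - 2) * x := by nlinarith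
  positivity

theorem alphaF_add_pos {n : ℕ} (hn : 3 ≤ n) {c x : ℝ} (hc : 0 < c) (hx : 0 < x) :
    0 < alphaF n c x + n * c := by
  have hn' : (3 : ℝ) ≤ n := by exact_mod_cast hn
  have hn1 : 0 < (n : ℝ) - 1 := by linarith
  have hle : Real.sqrt (x ^ 2 + 4 * ((n : ℝ) - 1) * c * x) ≤ x + 2 * (n - 1) * c := by
    rw [Real.sqrt_le_left (by positivity)]
    nlinarith [sq_nonneg (((n : ℝ) - 1) * c)]
  have hmul := mul_le_mul_of_nonneg_left hle (by linarith : (0 : ℝ) ≤ n - 2)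
  have hc1 : 0 < ((n : ℝ) - 1) * c := mul_pos hn1 hc
  have heq : alphaF n c x + n * c = (4 * n * ((n - 1) * c) + n * x
      - (n - 2) * Real.sqrt (x ^ 2 + 4 * ((n : ℝ) - 1) * c * x)) / (2 * (n - 1)) := by
    unfold alphaF
    field_simp
    ring
  rw [heq]
  exact div_pos (by nlinarith) (by positivity)

theorem alphaF_add_mul_deriv_omegaF {n : ℕ} (hn : 3 ≤ n) {c x : ℝ} (hc : 0 < c) (hx : 0 < x) :
    (alphaF n c x + n * c) * x * deriv (omegaF n c) x =
      (2 * alphaF n c x - x * deriv (alphaF n c) x - 3 * n * c) * omegaF n c x := by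
  have hn' : (3 : ℝ) ≤ n := by exact_mod_cast hn
  have hn1 : 0 < (n : ℝ) - 1 := by linarith
  have hk : 0 < 4 * ((n : ℝ) - 1) * c := mul_pos (by linarith) hc
  have hrd := hasDerivAt_sqrt_sq_add_linear hk hx
  have hr0 : 0 < Real.sqrt (x ^ 2 + 4 * ((n : ℝ) - 1) * c * x) := Real.sqrt_pos.2 (by positivity)
  have hω := (((hrd.const_mul (n : ℝ)).sub ((hasDerivAt_id x).const_mul ((n : ℝ) - 2))).pow 4).div
    (((hasDerivAt_pow 2 x).mul hrd).const_mul (16 * ((n : ℝ) - 1) ^ 2))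
    (by simp only [Pi.mul_apply]; positivity)
  have hω' : HasDerivAt (omegaF n c) _ x := hω.congr_of_eventuallyEq <| by
    filter_upwards [Ioi_mem_nhds hx] with y hy using omegaF_eq hn hc hy
  rw [hω'.deriv, (hasDerivAt_alphaF hn hc hx).deriv, omegaF_eq hn hc hx]
  unfold alphaF
  simp only [Pi.mul_apply, Pi.sub_apply, Pi.pow_apply, id]
  set m : ℝ := (n : ℝ)
  have hr2 : Real.sqrt (x ^ 2 + 4 * (m - 1) * c * x) ^ 2 = x ^ 2 + 4 * (m - 1) * c * x :=
    Real.sq_sqrt (by positivity)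
  generalize Real.sqrt (x ^ 2 + 4 * (m - 1) * c * x) = r at *
  obtain rfl : c = (r ^ 2 - x ^ 2) / (4 * (m - 1) * x) := by
    rw [eq_div_iff (by positivity)]
    linarith
  field_simp
  push_cast
  ring


theorem stmt_13 (n : ℕ) (hn : 3 ≤ n) (c : ℝ) (hc : 0 < c) (x : ℝ) (hx : x0 n c ≤ x) :
    (gammaF n c x + (n : ℝ) * c) * x * deriv (omegaF n c) x =
      (2 * gammaF n c x - x * gammaF' n c x - 3 * (n : ℝ) * c) * omegaF n c x ∧
    deriv (omegaF n c) x / omegaF n c x =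
      (2 * alphaF n c x - x * deriv (alphaF n c) x - 3 * (n : ℝ) * c) /
        (x * (alphaF n c x + (n : ℝ) * c)) := by
  have hx0 : 0 < x := (x0_pos hn hc).trans_le hx
  have hγ : gammaF n c x = alphaF n c x := if_pos hx
  have hγ' : gammaF' n c x = deriv (alphaF n c) x :=
    (hasDerivAt_gammaF hn hc hx).hasDerivWithinAt.derivWithin (uniqueDiffOn_Ici 0 x hx0.le)
  have hmain := alphaF_add_mul_deriv_omegaF hn hc hx0
  refine ⟨by rw [hγ, hγ']; exact hmain, ?_⟩
  rw [div_eq_div_iff (omegaF_pos hn hc hx0).ne' (mul_pos hx0 (alphaF_add_pos hn hc hx0)).ne']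
  linarith
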